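/- arXiv:1804.11086 — 7 statements merged into one kernel-verified Lean document; each statement's English description precedes it below -/
import Mathlib

section
/- Let U and M be finite nonempty sets with |M| = m, let H be a finite nonempty family of functions from U to M that is 1-universal (i.e., for all x, y ∈ U with x ≠ y, the fraction of h ∈ H with h(x) = h(y) is at most 1/m), and let S ⊆ U with |S| = n. For h ∈ H and x ∈ S write B_{h(x)} = {y ∈ S : h(y) = h(x)}. Then for every rational t with 2·n/m < t ≤ n, the average over h ∈ H of the number |{x ∈ S : |B_{h(x)}| ≥ t}| is strictly less than n/(t − 2·n/m). -/
/-- Summing a function of the bucket size over the elements of `S` amounts to summing over the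
buckets, each weighted by its size. -/
theorem sum_fiber_card_eq {U M : Type*} [Fintype M] [DecidableEq M]
    (h : U → M) (S : Finset U) (f : ℕ → ℚ) :
    ∑ x ∈ S, f (S.filter (fun y => h y = h x)).card =
      ∑ b : M, ((S.filter (fun y => h y = b)).card : ℚ) * f (S.filter (fun y => h y = b)).card := by
  rw [← Finset.sum_fiberwise S h]
  refine Finset.sum_congr rfl fun b _ => ?_
  rw [← nsmul_eq_mul, ← Finset.sum_const]
  refine Finset.sum_congr rfl fun x hx => ?_
  rw [(Finset.mem_filter.mp hx).2]

/-- A Chebyshev-type bound on the number of elements in large buckets of a single function. -/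
theorem card_large_fiber_mul_le {U M : Type*} [Fintype M] [Nonempty M] [DecidableEq M]
    (h : U → M) (S : Finset U) (t : ℚ) :
    ((S.filter (fun x => t ≤ ((S.filter (fun y => h y = h x)).card : ℚ))).card : ℚ) *
        (t - 2 * S.card / Fintype.card M) ≤
      ∑ x ∈ S, ((S.filter (fun y => h y = h x)).card : ℚ) -
        (S.card : ℚ) ^ 2 / Fintype.card M := by
  have hm : (Fintype.card M : ℚ) ≠ 0 := by exact_mod_cast Fintype.card_ne_zero
  set α : ℚ := S.card / Fintype.card M with hα
  have hlarge := sum_fiber_card_eq h S (fun k => if t ≤ (k : ℚ) then 1 else 0)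
  have hsq := sum_fiber_card_eq h S (fun k => (k : ℚ))
  have hone := sum_fiber_card_eq h S (fun _ => 1)
  simp only [Finset.sum_const, nsmul_eq_mul, mul_one] at hone
  have hvar : ∑ x ∈ S, ((S.filter (fun y => h y = h x)).card : ℚ) -
      (S.card : ℚ) ^ 2 / Fintype.card M =
      ∑ b : M, (((S.filter (fun y => h y = b)).card : ℚ) - α) ^ 2 := by
    have hexpand : ∀ b : M, (((S.filter (fun y => h y = b)).card : ℚ) - α) ^ 2 =
        ((S.filter (fun y => h y = b)).card : ℚ) * ((S.filter (fun y => h y = b)).card : ℚ) -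
          2 * α * ((S.filter (fun y => h y = b)).card : ℚ) + α ^ 2 := fun b => by ring
    simp only [hexpand, Finset.sum_add_distrib, Finset.sum_sub_distrib, ← Finset.mul_sum,
      Finset.sum_const, Finset.card_univ, nsmul_eq_mul]
    rw [hsq, ← hone, hα]
    field_simp
    ring
  rw [hvar, Finset.natCast_card_filter, hlarge, Finset.sum_mul]
  refine Finset.sum_le_sum fun b _ => ?_
  have hα' : 2 * (S.card : ℚ) / Fintype.card M = 2 * α := by rw [hα]; ring
  rw [hα']
  split_ifs with hb
  · have := mul_le_mul_of_nonneg_left hb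
      (Nat.cast_nonneg (α := ℚ) (S.filter (fun y => h y = b)).card)
    nlinarith [sq_nonneg α]
  · simpa using sq_nonneg _

/-- For a 1-universal family, the total number of colliding ordered pairs is at most
`|H| * (n + n * (n - 1) / m)`. -/
theorem sum_sum_fiber_card_le {U M : Type*} [DecidableEq M] (m : ℚ)
    (H : Finset (U → M)) (hH : H.Nonempty)
    (huniv : ∀ x y : U, x ≠ y →
      ((H.filter (fun h => h x = h y)).card : ℚ) / H.card ≤ 1 / m)
    (S : Finset U) :
    ∑ h ∈ H, ∑ x ∈ S, ((S.filter (fun y => h y = h x)).card : ℚ) ≤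
      H.card * (S.card + S.card * (S.card - 1) / m) := by
  classical
  have hc : (0 : ℚ) < H.card := by exact_mod_cast hH.card_pos
  have hswap : ∑ h ∈ H, ∑ x ∈ S, ((S.filter (fun y => h y = h x)).card : ℚ) =
      ∑ x ∈ S, ∑ y ∈ S, ((H.filter (fun h => h y = h x)).card : ℚ) := by
    simp only [Finset.natCast_card_filter]
    rw [Finset.sum_comm]
    exact Finset.sum_congr rfl fun x _ => Finset.sum_comm
  have hrow : ∀ x ∈ S, ∑ y ∈ S, ((H.filter (fun h => h y = h x)).card : ℚ) ≤
      H.card + (S.card - 1) * (H.card / m) := by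
    intro x hx
    rw [← Finset.add_sum_erase S _ hx]
    have hle : ∑ y ∈ S.erase x, ((H.filter (fun h => h y = h x)).card : ℚ) ≤
        (S.erase x).card • ((H.card : ℚ) / m) := by
      refine Finset.sum_le_card_nsmul _ _ _ fun y hy => ?_
      have := (div_le_iff₀ hc).mp (huniv y x (Finset.ne_of_mem_erase hy))
      rwa [one_div_mul_eq_div] at this
    rw [nsmul_eq_mul, Finset.cast_card_erase_of_mem hx] at hle
    simpa using hle
  rw [hswap]
  refine (Finset.sum_le_card_nsmul _ _ _ hrow).trans_eq ?_
  rw [nsmul_eq_mul]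
  ring


/-- **Hashing lemma for 1-universal families.**
If `H` is a nonempty finite 1-universal family of hash functions from `U` to `M`
(with `|M| = m`), `S ⊆ U` has `n` elements, and `t` is a rational with
`2·n/m < t ≤ n`, then the average over `h ∈ H` of the number of `x ∈ S`
whose bucket `B_{h(x)} = {y ∈ S : h y = h x}` has size at least `t`
is strictly less than `n / (t - 2·n/m)`. -/
theorem stmt_0 {U M : Type*} [Fintype U] [Fintype M] [Nonempty U] [Nonempty M]
    [DecidableEq M]
    (m : ℕ) (hm : Fintype.card M = m)
    (H : Finset (U → M)) (hH : H.Nonempty)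
    (huniv : ∀ x y : U, x ≠ y →
      ((H.filter (fun h => h x = h y)).card : ℚ) / H.card ≤ 1 / m)
    (S : Finset U) (n : ℕ) (hn : S.card = n)
    (t : ℚ) (ht1 : 2 * n / m < t) (ht2 : t ≤ n) :
    (∑ h ∈ H, ((S.filter (fun x =>
        t ≤ ((S.filter (fun y => h y = h x)).card : ℚ))).card : ℚ)) / H.card
      < n / (t - 2 * n / m) := by
  subst hm hn
  have hm : (0 : ℚ) < Fintype.card M := by exact_mod_cast Fintype.card_pos
  have hc : (0 : ℚ) < H.card := by exact_mod_cast hH.card_pos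
  have hn : (0 : ℚ) < S.card := (lt_of_le_of_lt (by positivity) ht1).trans_le ht2
  rw [lt_div_iff₀ (sub_pos.mpr ht1), div_mul_eq_mul_div, div_lt_iff₀ hc, Finset.sum_mul]
  calc _ ≤ ∑ h ∈ H, (∑ x ∈ S, ((S.filter (fun y => h y = h x)).card : ℚ) -
          (S.card : ℚ) ^ 2 / Fintype.card M) :=
        Finset.sum_le_sum fun h _ => card_large_fiber_mul_le h S t
    _ ≤ H.card * (S.card + S.card * (S.card - 1) / Fintype.card M) -
          H.card * ((S.card : ℚ) ^ 2 / Fintype.card M) := by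
        rw [Finset.sum_sub_distrib, Finset.sum_const, nsmul_eq_mul]
        exact sub_le_sub_right (sum_sum_fiber_card_le _ H hH huniv S) _
    _ = S.card * H.card - H.card * S.card / Fintype.card M := by ring
    _ < S.card * H.card := sub_lt_self _ (by positivity)
end

section
/- Let U and M be finite nonempty sets with |M| = m ≥ 3, let H be a finite nonempty 1-universal family of functions from U to M, and let S ⊆ U with |S| = n. Then the average over h ∈ H of the number of elements x ∈ S whose bucket B_{h(x)} = {y ∈ S : h(y) = h(x)} has size at least 3·n/m is strictly less than m. -/
/-- The second moment of the bucket sizes of `f` on `S` counts the colliding ordered pairs. -/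
lemma sum_card_fiber_sq {U M : Type*} [Fintype M] [DecidableEq M] (f : U → M) (S : Finset U) :
    ∑ z : M, ((S.filter (fun y => f y = z)).card : ℚ) ^ 2 =
      ∑ x ∈ S, ∑ y ∈ S, if f x = f y then (1 : ℚ) else 0 := by
  have h : ∀ x ∈ S, ∑ y ∈ S, (if f x = f y then (1 : ℚ) else 0) =
      ((S.filter (fun y => f y = f x)).card : ℚ) := by
    intro x _
    rw [Finset.sum_boole]
    simp only [eq_comm]
  rw [Finset.sum_congr rfl h, ← Finset.sum_fiberwise S f]
  refine Finset.sum_congr rfl fun z _ => ?_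
  rw [Finset.sum_congr rfl (g := fun _ => ((S.filter (fun y => f y = z)).card : ℚ))]
  · rw [Finset.sum_const, nsmul_eq_mul, sq]
  · intro x hx
    rw [(Finset.mem_filter.mp hx).2]

/-- A Chebyshev-type bound on the number of elements of `S` in buckets of size at least `3 * a`. -/
lemma card_heavy_le {U M : Type*} [Fintype M] [DecidableEq M] (f : U → M) (S : Finset U)
    (a : ℚ) (ha : 0 ≤ a) :
    4 * a / 3 * ((S.filter (fun x =>
        3 * a ≤ ((S.filter (fun y => f y = f x)).card : ℚ))).card : ℚ) ≤
      ∑ z : M, ((S.filter (fun y => f y = z)).card : ℚ) ^ 2 - 2 * a * S.card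
        + Fintype.card M * a ^ 2 := by
  have hcard : (S.card : ℚ) = ∑ z : M, ((S.filter (fun y => f y = z)).card : ℚ) := by
    exact_mod_cast Finset.card_eq_sum_card_fiberwise (f := f) (s := S) (t := Finset.univ)
      (fun x _ => by simp)
  have hheavy : ((S.filter (fun x =>
      3 * a ≤ ((S.filter (fun y => f y = f x)).card : ℚ))).card : ℚ) =
      ∑ z : M, if 3 * a ≤ ((S.filter (fun y => f y = z)).card : ℚ)
        then ((S.filter (fun y => f y = z)).card : ℚ) else 0 := by
    rw [← Finset.sum_boole, ← Finset.sum_fiberwise S f]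
    refine Finset.sum_congr rfl fun z _ => ?_
    rw [Finset.sum_congr rfl (g := fun _ =>
      if 3 * a ≤ ((S.filter (fun y => f y = z)).card : ℚ) then (1 : ℚ) else 0)]
    · rw [Finset.sum_const, nsmul_eq_mul, mul_ite, mul_one, mul_zero]
    · intro x hx
      rw [(Finset.mem_filter.mp hx).2]
  have hsq : ∑ z : M, (((S.filter (fun y => f y = z)).card : ℚ) - a) ^ 2 =
      ∑ z : M, ((S.filter (fun y => f y = z)).card : ℚ) ^ 2 - 2 * a * S.card
        + Fintype.card M * a ^ 2 := by
    rw [hcard, Finset.mul_sum, ← Finset.sum_sub_distrib, ← nsmul_eq_mul, ← Finset.card_univ,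
      ← Finset.sum_const, ← Finset.sum_add_distrib]
    exact Finset.sum_congr rfl fun z _ => by ring
  rw [hheavy, ← hsq, Finset.mul_sum]
  refine Finset.sum_le_sum fun z _ => ?_
  split_ifs with hz
  · nlinarith [mul_nonneg (sub_nonneg.mpr hz) ha, sq_nonneg
      (((S.filter (fun y => f y = z)).card : ℚ) - 3 * a)]
  · rw [mul_zero]
    exact sq_nonneg _

/-- Collision count of a family in which any two distinct points collide at most `c` times. -/
lemma sum_collisions_le {U M : Type*} [DecidableEq M] (H : Finset (U → M)) (c : ℚ)
    (hc : ∀ x y : U, x ≠ y → ((H.filter (fun h => h x = h y)).card : ℚ) ≤ c)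
    (S : Finset U) :
    ∑ h ∈ H, ∑ x ∈ S, ∑ y ∈ S, (if h x = h y then (1 : ℚ) else 0) ≤
      S.card * (H.card + (S.card - 1) * c) := by
  classical
  rw [Finset.sum_comm, ← nsmul_eq_mul]
  refine Finset.sum_le_card_nsmul _ _ _ fun x hx => ?_
  rw [Finset.sum_comm, ← Finset.add_sum_erase S _ hx]
  refine add_le_add (by simp) ?_
  have hcard : (((S.erase x).card : ℕ) : ℚ) = S.card - 1 := by
    rw [← Finset.card_erase_add_one hx]
    push_cast
    ring
  rw [← hcard, ← nsmul_eq_mul]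
  refine Finset.sum_le_card_nsmul _ _ _ fun y hy => ?_
  rw [Finset.sum_boole]
  exact hc x y (Finset.ne_of_mem_erase hy).symm

/-- **Bucket-counting corollary of the hashing lemma.**
If `H` is a nonempty finite 1-universal family of hash functions from `U` to `M`
(with `|M| = m ≥ 3`) and `S ⊆ U` has `n` elements, then the average over
`h ∈ H` of the number of `x ∈ S` whose bucket `B_{h(x)} = {y ∈ S : h y = h x}`
has size at least `3·n/m` is strictly less than `m`. -/
theorem stmt_1 {U M : Type*} [Fintype U] [Fintype M] [Nonempty U] [Nonempty M]
    [DecidableEq M]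
    (m : ℕ) (hm : Fintype.card M = m) (hm3 : 3 ≤ m)
    (H : Finset (U → M)) (hH : H.Nonempty)
    (huniv : ∀ x y : U, x ≠ y →
      ((H.filter (fun h => h x = h y)).card : ℚ) / H.card ≤ 1 / m)
    (S : Finset U) (n : ℕ) (hn : S.card = n) :
    (∑ h ∈ H, ((S.filter (fun x =>
        (3 * n / m : ℚ) ≤ ((S.filter (fun y => h y = h x)).card : ℚ))).card : ℚ)) / H.card
      < m := by
  have hmpos : (0 : ℚ) < m := by
    have : 0 < m := by omega
    exact_mod_cast this
  have hHpos : (0 : ℚ) < H.card := by exact_mod_cast hH.card_pos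
  rcases Nat.eq_zero_or_pos n with rfl | hnpos
  · rw [Finset.card_eq_zero] at hn
    subst hn
    simpa using hmpos
  have hnq : (0 : ℚ) < n := by exact_mod_cast hnpos
  rw [div_lt_iff₀ hHpos]
  have hcoll := sum_collisions_le H (H.card / m) (fun x y hxy => by
    have := (div_le_iff₀ hHpos).mp (huniv x y hxy)
    calc _ ≤ _ := this
      _ = _ := by ring) S
  have hsum := Finset.sum_le_sum fun h (_ : h ∈ H) =>
    card_heavy_le h S ((n : ℚ) / m) (by positivity)
  simp only [← mul_div_assoc (3 : ℚ), sum_card_fiber_sq] at hsum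
  rw [← Finset.mul_sum, Finset.sum_add_distrib, Finset.sum_sub_distrib, Finset.sum_const,
    Finset.sum_const, nsmul_eq_mul, nsmul_eq_mul, hm, hn] at hsum
  rw [hn] at hcoll
  set K : ℚ := ∑ h ∈ H, ((S.filter (fun x =>
    (3 * n / m : ℚ) ≤ ((S.filter (fun y => h y = h x)).card : ℚ))).card : ℚ)
  have hbound : 4 * ((n : ℚ) / m) / 3 * K ≤ n * H.card * (1 - 1 / m) := by
    have key : (n : ℚ) * (H.card + (n - 1) * (H.card / m)) - H.card * (2 * (n / m) * n)
        + H.card * (m * (n / m) ^ 2) = n * H.card * (1 - 1 / m) := by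
      field_simp
      ring
    linarith
  have hlt : 4 * ((n : ℚ) / m) / 3 * K < 4 * ((n : ℚ) / m) / 3 * (m * H.card) := by
    have h1 : 4 * ((n : ℚ) / m) / 3 * (m * H.card) = n * H.card * (4 / 3) := by
      field_simp
    rw [h1]
    refine hbound.trans_lt (mul_lt_mul_of_pos_left ?_ (by positivity))
    have : (0 : ℚ) < 1 / m := by positivity
    linarith
  exact lt_of_mul_lt_mul_left hlt (by positivity)
end

section
/- Let U and M be finite nonempty sets with |M| = m ≥ 3, let H be a finite nonempty 1-universal family of functions from U to M, and let S ⊆ U with |S| = n. Then the fraction of h ∈ H for which the number of elements x ∈ S whose bucket B_{h(x)} = {y ∈ S : h(y) = h(x)} has size at least 3·n/m is at least 2·m, is strictly less than 1/2. -/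
/-- Summing over elements a function of their hash value, grouped by bucket. -/
lemma sum_comp_eq_sum_bucket_card_mul {U M : Type*} [Fintype M] [DecidableEq M]
    (S : Finset U) (h : U → M) (f : M → ℚ) :
    ∑ x ∈ S, f (h x) = ∑ i, ((S.filter (fun y => h y = i)).card : ℚ) * f i := by
  rw [← Finset.sum_fiberwise' S h f]
  simp

/-- The number of elements in buckets of at least three times the mean size is controlled by
the number of colliding ordered pairs. -/
lemma mean_mul_card_overfull_le {U M : Type*} [Fintype M] [Nonempty M] [DecidableEq M]
    (S : Finset U) (h : U → M) (a : ℚ) (ha : a * Fintype.card M = S.card) :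
    a * ((S.filter (fun x =>
        3 * a ≤ ((S.filter (fun y => h y = h x)).card : ℚ))).card : ℚ)
      ≤ ∑ x ∈ S, ((S.filter (fun y => h y = h x)).card : ℚ) - a * S.card := by
  have ha0 : 0 ≤ a := by
    have hM : (0 : ℚ) < Fintype.card M := by exact_mod_cast Fintype.card_pos
    by_contra! hneg
    have := mul_neg_of_neg_of_pos hneg hM
    have : (0 : ℚ) ≤ S.card := by positivity
    linarith
  have hone := sum_comp_eq_sum_bucket_card_mul S h (fun _ => 1)
  have hsq := sum_comp_eq_sum_bucket_card_mul S h
    (fun i => ((S.filter (fun y => h y = i)).card : ℚ))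
  have hbad := sum_comp_eq_sum_bucket_card_mul S h
    (fun i => if 3 * a ≤ ((S.filter (fun y => h y = i)).card : ℚ) then 1 else 0)
  simp only [Finset.sum_const, nsmul_eq_mul, mul_one] at hone
  rw [Finset.sum_boole] at hbad
  rw [hbad, hsq]
  have key : ∑ i : M, a * (((S.filter (fun y => h y = i)).card : ℚ) *
        (if 3 * a ≤ ((S.filter (fun y => h y = i)).card : ℚ) then 1 else 0)) ≤
      ∑ i : M, (((S.filter (fun y => h y = i)).card : ℚ) * (S.filter (fun y => h y = i)).card
        - 2 * a * (S.filter (fun y => h y = i)).card + a * a) := by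
    refine Finset.sum_le_sum fun i _ => ?_
    generalize ((S.filter (fun y => h y = i)).card : ℚ) = b
    split_ifs with hb
    · nlinarith [mul_nonneg ha0 ha0, mul_nonneg (sub_nonneg.2 hb) ha0,
        mul_nonneg (sub_nonneg.2 hb) (sub_nonneg.2 hb)]
    · nlinarith [sq_nonneg (b - a)]
  rw [← Finset.mul_sum, Finset.sum_add_distrib, Finset.sum_sub_distrib, ← Finset.mul_sum,
    ← hone] at key
  simp only [Finset.sum_const, nsmul_eq_mul, Finset.card_univ] at key
  have : (Fintype.card M : ℚ) * (a * a) = a * S.card := by rw [← ha]; ring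
  linarith

/-- The expected number of colliding ordered pairs under a 1-universal family. -/
lemma sum_bucket_card_le {U M : Type*} [DecidableEq M] (H : Finset (U → M)) (c : ℚ)
    (huniv : ∀ x y : U, x ≠ y → ((H.filter (fun h => h x = h y)).card : ℚ) ≤ c)
    (S : Finset U) :
    ∑ h ∈ H, ∑ x ∈ S, ((S.filter (fun y => h y = h x)).card : ℚ)
      ≤ S.card * (H.card + (S.card - 1) * c) := by
  classical
  have hpoint : ∀ x ∈ S, ∑ h ∈ H, ((S.filter (fun y => h y = h x)).card : ℚ)
      ≤ H.card + (S.card - 1) * c := by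
    intro x hx
    have hswap : ∑ h ∈ H, ((S.filter (fun y => h y = h x)).card : ℚ)
        = ∑ y ∈ S, ((H.filter (fun h => h y = h x)).card : ℚ) := by
      simp only [Finset.natCast_card_filter]
      exact Finset.sum_comm
    have hself : ((H.filter (fun h => h x = h x)).card : ℚ) ≤ H.card := by
      exact Nat.cast_le.2 (Finset.card_filter_le _ _)
    have hle : ∀ y ∈ S.erase x, ((H.filter (fun h => h y = h x)).card : ℚ) ≤ c :=
      fun y hy => huniv y x (Finset.ne_of_mem_erase hy)
    have hrest := Finset.sum_le_card_nsmul _ _ _ hle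
    rw [nsmul_eq_mul, Finset.cast_card_erase_of_mem hx] at hrest
    rw [hswap, ← Finset.add_sum_erase S _ hx]
    exact add_le_add hself hrest
  rw [Finset.sum_comm, ← nsmul_eq_mul]
  exact Finset.sum_le_card_nsmul _ _ _ hpoint

/-- **Markov bound for the number of elements in overfull buckets.**
If `H` is a nonempty finite 1-universal family of hash functions from `U` to `M`
(with `|M| = m ≥ 3`) and `S ⊆ U` has `n` elements, then the fraction of `h ∈ H`
for which at least `2·m` elements `x ∈ S` have a bucket
`B_{h(x)} = {y ∈ S : h y = h x}` of size at least `3·n/m`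
is strictly less than `1/2`. -/
theorem stmt_2 {U M : Type*} [Fintype U] [Fintype M] [Nonempty U] [Nonempty M]
    [DecidableEq M]
    (m : ℕ) (hm : Fintype.card M = m) (hm3 : 3 ≤ m)
    (H : Finset (U → M)) (hH : H.Nonempty)
    (huniv : ∀ x y : U, x ≠ y →
      ((H.filter (fun h => h x = h y)).card : ℚ) / H.card ≤ 1 / m)
    (S : Finset U) (n : ℕ) (hn : S.card = n) :
    (((H.filter (fun h => 2 * m ≤ (S.filter (fun x =>
        (3 * n / m : ℚ) ≤ ((S.filter (fun y => h y = h x)).card : ℚ))).card)).card : ℚ))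
      / H.card < 1 / 2 := by
  have hHpos : (0 : ℚ) < H.card := by exact_mod_cast hH.card_pos
  have hmpos : (0 : ℚ) < m := by exact_mod_cast (by omega : 0 < m)
  rcases Nat.eq_zero_or_pos n with rfl | hnpos
  · have hS : S = ∅ := Finset.card_eq_zero.1 hn
    have hm0 : m ≠ 0 := by omega
    simp [hS, hm0]
  have hnpos' : (0 : ℚ) < n := by exact_mod_cast hnpos
  rw [div_lt_iff₀ hHpos]
  set bad : (U → M) → ℕ := fun h => (S.filter (fun x =>
    (3 * n / m : ℚ) ≤ ((S.filter (fun y => h y = h x)).card : ℚ))).card with hbad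
  have hpairs := sum_bucket_card_le H (H.card / m) (fun x y hxy => by
    have := (div_le_iff₀ hHpos).1 (huniv x y hxy)
    rwa [one_div_mul_eq_div] at this) S
  have hpoint : ∀ h ∈ H, (n / m : ℚ) * bad h ≤
      ∑ x ∈ S, ((S.filter (fun y => h y = h x)).card : ℚ) - n / m * n := by
    intro h _
    have := mean_mul_card_overfull_le S h (n / m : ℚ)
      (by rw [hm, hn]; field_simp)
    simpa only [hbad, mul_div_assoc, hn] using this
  have hsum := Finset.sum_le_sum hpoint
  rw [← Finset.mul_sum, Finset.sum_sub_distrib, Finset.sum_const, nsmul_eq_mul] at hsum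
  rw [hn] at hpairs
  have hmean : ∑ h ∈ H, (bad h : ℚ) ≤ H.card * (m - 1) := by
    refine le_of_mul_le_mul_left ?_ (div_pos hnpos' hmpos)
    have hid : (n / m : ℚ) * (H.card * (m - 1)) =
        n * (H.card + (n - 1) * (H.card / m)) - H.card * (n / m * n) := by
      field_simp
      ring
    linarith
  have hmarkov : ((H.filter (fun h => 2 * m ≤ bad h)).card : ℚ) * (2 * m) ≤
      ∑ h ∈ H, (bad h : ℚ) := by
    rw [← nsmul_eq_mul]
    refine (Finset.card_nsmul_le_sum _ (fun h => (bad h : ℚ)) _ fun h hh => ?_).trans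
      (Finset.sum_le_sum_of_subset_of_nonneg (Finset.filter_subset _ _) fun _ _ _ => by
        positivity)
    exact_mod_cast (Finset.mem_filter.1 hh).2
  refine lt_of_mul_lt_mul_right (a := (2 * m : ℚ)) ?_ (by positivity)
  linarith
end

section
/- Let ℓ, μ ≥ 1 be natural numbers and let z ∈ (ZMod 2)^ℓ with z ≠ 0. Then the number of vectors a ∈ (ZMod 2)^{ℓ+μ−1} such that for every i with 0 ≤ i < μ one has ∑_{j=0}^{ℓ−1} a_{i+j}·z_j = 0 in ZMod 2 is exactly 2^{ℓ−1}. Consequently, for distinct x, y ∈ (ZMod 2)^ℓ, a uniformly random a ∈ (ZMod 2)^{ℓ+μ−1} satisfies h_a(x) = h_a(y) with probability exactly 2^{−μ}, i.e., the convolution family is 1-universal. -/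
theorem exists_ne_zero_and_forall_gt_eq_zero {n : ℕ} {M : Type*} [Zero M] {v : Fin n → M}
    (hv : v ≠ 0) : ∃ k, v k ≠ 0 ∧ ∀ j, k < j → v j = 0 := by
  classical
  obtain ⟨i, hi⟩ := Function.ne_iff.mp hv
  obtain ⟨k, hk, hmax⟩ := (Finset.univ.filter fun j => v j ≠ 0).exists_max_image id
    ⟨i, by simpa using hi⟩
  refine ⟨k, by simpa using hk, fun j hj => ?_⟩
  by_contra h
  exact absurd (hmax j (by simpa using h)) (not_le.mpr hj)

/-- The linear map `a ↦ A_a z`, where `A_a` is the Hankel matrix with entries `a (i + j)`. -/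
def hankelApply {K : Type*} [Field K] {l m N : ℕ} (h : l + m ≤ N + 1) (z : Fin l → K) :
    (Fin N → K) →ₗ[K] (Fin m → K) where
  toFun a i := ∑ j : Fin l, a ⟨(i : ℕ) + (j : ℕ), by have := i.isLt; have := j.isLt; omega⟩ * z j
  map_add' a b := by ext i; simp [add_mul, Finset.sum_add_distrib]
  map_smul' c a := by ext i; simp [Finset.mul_sum, mul_assoc]

theorem hankelApply_apply {K : Type*} [Field K] {l m N : ℕ} (h : l + m ≤ N + 1) (z : Fin l → K)
    (a : Fin N → K) (i : Fin m) : hankelApply h z a i =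
      ∑ j : Fin l, a ⟨(i : ℕ) + (j : ℕ), by have := i.isLt; have := j.isLt; omega⟩ * z j :=
  rfl

theorem hankelApply_surjective {K : Type*} [Field K] {l m N : ℕ} (h : l + m ≤ N + 1)
    {z : Fin l → K} (hz : z ≠ 0) : Function.Surjective (hankelApply (m := m) h z) := by
  classical
  rw [← LinearMap.range_eq_top]
  by_contra hne
  obtain ⟨f, hf, hle⟩ := Submodule.exists_le_ker_of_lt_top _ (lt_top_iff_ne_top.mpr hne)
  have hc : (fun i => f (Pi.single i 1)) ≠ 0 := by
    intro hc
    exact hf (LinearMap.pi_ext' fun i => LinearMap.ext_ring (congrFun hc i))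
  obtain ⟨p, hp, hp'⟩ := exists_ne_zero_and_forall_gt_eq_zero hc
  obtain ⟨k, hk, hk'⟩ := exists_ne_zero_and_forall_gt_eq_zero hz
  have key := hle ⟨Pi.single ⟨(p : ℕ) + (k : ℕ), by have := p.isLt; have := k.isLt; omega⟩ 1, rfl⟩
  rw [LinearMap.mem_ker, LinearMap.pi_apply_eq_sum_univ f, Finset.sum_eq_single p] at key
  · have hs : (fun j => if p = j then (1 : K) else 0) = Pi.single p 1 := by
      ext j; simp [Pi.single_apply, eq_comm]
    rw [hs, smul_eq_mul] at key
    refine (mul_ne_zero ?_ hp) key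
    simpa [hankelApply_apply, Pi.single_apply, Fin.val_inj] using hk
  · intro i _ hi
    have hs : (fun j => if i = j then (1 : K) else 0) = Pi.single i 1 := by
      ext j; simp [Pi.single_apply, eq_comm]
    rw [hs]
    rcases lt_or_gt_of_ne hi with hlt | hgt
    · rw [smul_eq_mul, hankelApply_apply]
      refine mul_eq_zero_of_left (Finset.sum_eq_zero fun j _ => ?_) _
      by_cases hj : (i : ℕ) + j = p + k
      · rw [hk' j (by rw [Fin.lt_def] at hlt ⊢; omega), mul_zero]
      · simp [hj]
    · rw [show f (Pi.single i 1) = 0 from hp' i hgt, smul_zero]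
  · simp

theorem card_ker_hankelApply {K : Type*} [Field K] [Fintype K] {l m N : ℕ} (h : l + m ≤ N + 1)
    {z : Fin l → K} (hz : z ≠ 0) :
    Nat.card (LinearMap.ker (hankelApply (m := m) h z)) = Fintype.card K ^ (N - m) := by
  have hrank := (hankelApply (m := m) h z).finrank_range_add_finrank_ker
  rw [LinearMap.range_eq_top.mpr (hankelApply_surjective h hz), finrank_top,
    Module.finrank_fin_fun, Module.finrank_fin_fun] at hrank
  rw [Module.natCard_eq_pow_finrank (K := K), Nat.card_eq_fintype_card,
    Nat.eq_sub_of_add_eq' hrank]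

/-- **1-universality of the convolution family of hash functions.**
For `ℓ, μ ≥ 1` and `z ∈ (ZMod 2)^ℓ` with `z ≠ 0`, exactly `2^(ℓ−1)` of the
vectors `a ∈ (ZMod 2)^(ℓ+μ−1)` satisfy `∑_{j<ℓ} a_{i+j}·z_j = 0` for all
`i < μ`; consequently, for distinct `x, y ∈ (ZMod 2)^ℓ`, a uniformly random
`a` satisfies `h_a(x) = h_a(y)` with probability exactly `2^{-μ}`, where
`h_a(x)_i = ∑_{j<ℓ} a_{i+j}·x_j`. -/
theorem stmt_5 (ℓ μ : ℕ) (hℓ : 1 ≤ ℓ) (hμ : 1 ≤ μ) :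
    (∀ z : Fin ℓ → ZMod 2, z ≠ 0 →
      (Finset.univ.filter (fun a : Fin (ℓ + μ - 1) → ZMod 2 =>
        ∀ i : Fin μ, ∑ j : Fin ℓ,
          a ⟨(i : ℕ) + (j : ℕ), by have := i.isLt; have := j.isLt; omega⟩ * z j
            = 0)).card = 2 ^ (ℓ - 1)) ∧
    (∀ x y : Fin ℓ → ZMod 2, x ≠ y →
      ((Finset.univ.filter (fun a : Fin (ℓ + μ - 1) → ZMod 2 =>
        ∀ i : Fin μ, (∑ j : Fin ℓ,
            a ⟨(i : ℕ) + (j : ℕ), by have := i.isLt; have := j.isLt; omega⟩ * x j)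
          = ∑ j : Fin ℓ,
            a ⟨(i : ℕ) + (j : ℕ), by have := i.isLt; have := j.isLt; omega⟩ * y j)).card : ℚ)
        / (Fintype.card (Fin (ℓ + μ - 1) → ZMod 2)) = 1 / 2 ^ μ) := by
  have hcard : ∀ z : Fin ℓ → ZMod 2, z ≠ 0 →
      (Finset.univ.filter (fun a : Fin (ℓ + μ - 1) → ZMod 2 =>
        ∀ i : Fin μ, ∑ j : Fin ℓ,
          a ⟨(i : ℕ) + (j : ℕ), by have := i.isLt; have := j.isLt; omega⟩ * z j
            = 0)).card = 2 ^ (ℓ - 1) := by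
    intro z hz
    have hker := card_ker_hankelApply (m := μ) (N := ℓ + μ - 1) (by omega) hz
    rw [ZMod.card, show ℓ + μ - 1 - μ = ℓ - 1 by omega] at hker
    rw [← hker, ← Fintype.card_subtype, ← Nat.card_eq_fintype_card]
    exact Nat.card_congr (Equiv.subtypeEquivRight fun a => funext_iff.symm)
  refine ⟨hcard, fun x y hxy => ?_⟩
  have hdiff := hcard (x - y) (sub_ne_zero.mpr hxy)
  simp only [Pi.sub_apply, mul_sub, Finset.sum_sub_distrib, sub_eq_zero] at hdiff
  rw [hdiff, Fintype.card_fun, ZMod.card, Fintype.card_fin,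
    show ℓ + μ - 1 = (ℓ - 1) + μ by omega, pow_add]
  push_cast
  field_simp
end

section
/- Let w ≥ 1, let k < w, and let X₀, X₁ be sets of bitstrings in {0,1}^w such that all elements of X₀ ∪ X₁ agree on the coordinates 0, …, k−1, every x ∈ X₀ satisfies x(k) = false, and every y ∈ X₁ satisfies y(k) = true. Then for every a ∈ {0,1}^w: if a(k) = false then a ⊕ x < a ⊕ y in the lexicographic order for all x ∈ X₀ and y ∈ X₁, and if a(k) = true then a ⊕ y < a ⊕ x for all x ∈ X₀ and y ∈ X₁. -/
/-- Lexicographic strict order on bitstrings `Fin w → Bool`, where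
`Bool` is ordered by `false < true`. -/
def lexLt {w : ℕ} (x y : Fin w → Bool) : Prop :=
  ∃ k : Fin w, (∀ i : Fin w, i < k → x i = y i) ∧ x k < y k

/-- Coordinatewise XOR of bitstrings. -/
def fxor {w : ℕ} (x y : Fin w → Bool) : Fin w → Bool :=
  fun i => xor (x i) (y i)

/-- XOR with `a` preserves a first difference at `k` when `a k = false`. -/
theorem lexLt_fxor_of_eq_false {w : ℕ} {a x y : Fin w → Bool} {k : Fin w}
    (h : ∀ i < k, x i = y i) (hx : x k = false) (hy : y k = true) (ha : a k = false) :
    lexLt (fxor a x) (fxor a y) :=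
  ⟨k, fun i hi => by simp [fxor, h i hi], by simp [fxor, hx, hy, ha]⟩

/-- XOR with `a` reverses a first difference at `k` when `a k = true`. -/
theorem lexLt_fxor_of_eq_true {w : ℕ} {a x y : Fin w → Bool} {k : Fin w}
    (h : ∀ i < k, x i = y i) (hx : x k = false) (hy : y k = true) (ha : a k = true) :
    lexLt (fxor a y) (fxor a x) :=
  ⟨k, fun i hi => by simp [fxor, h i hi], by simp [fxor, hx, hy, ha]⟩

/-- **Correctness invariant of the traversal of `T_X`.**
Suppose all elements of `X₀ ∪ X₁` agree on coordinates `< k`, elements of `X₀`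
have bit `k` equal to `false` and elements of `X₁` have bit `k` equal to
`true`. Then for every `a`: if `a(k) = false`, all of `a ⊕ X₀` precedes all of
`a ⊕ X₁` lexicographically, and if `a(k) = true`, the order is reversed. -/
theorem stmt_8 (w : ℕ) (hw : 1 ≤ w) (k : ℕ) (hk : k < w)
    (X₀ X₁ : Set (Fin w → Bool))
    (hagree : ∀ x ∈ X₀ ∪ X₁, ∀ y ∈ X₀ ∪ X₁, ∀ i : Fin w, (i : ℕ) < k → x i = y i)
    (hX₀ : ∀ x ∈ X₀, x ⟨k, hk⟩ = false)
    (hX₁ : ∀ y ∈ X₁, y ⟨k, hk⟩ = true)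
    (a : Fin w → Bool) :
    (a ⟨k, hk⟩ = false →
      ∀ x ∈ X₀, ∀ y ∈ X₁, lexLt (fxor a x) (fxor a y)) ∧
    (a ⟨k, hk⟩ = true →
      ∀ x ∈ X₀, ∀ y ∈ X₁, lexLt (fxor a y) (fxor a x)) := by
  have agree : ∀ x ∈ X₀, ∀ y ∈ X₁, ∀ i < (⟨k, hk⟩ : Fin w), x i = y i :=
    fun x hx y hy i hi => hagree x (Or.inl hx) y (Or.inr hy) i hi
  exact ⟨fun ha x hx y hy => lexLt_fxor_of_eq_false (agree x hx y hy) (hX₀ x hx) (hX₁ y hy) ha,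
    fun ha x hx y hy => lexLt_fxor_of_eq_true (agree x hx y hy) (hX₀ x hx) (hX₁ y hy) ha⟩
end

section
/- Let w ≥ 1 and let x₁ < x₂ < ⋯ < x_n (n ≥ 2) be distinct bitstrings in {0,1}^w, sorted in lexicographic order. Let k be the smallest coordinate at which not all of x₁, …, x_n agree, and let m (1 ≤ m < n) be the unique index with x_m(k) = false and x_{m+1}(k) = true. Then for every i with 1 ≤ i < n and i ≠ m, the consecutive XOR satisfies x_i ⊕ x_{i+1} < x_m ⊕ x_{m+1} in the lexicographic order; i.e., the maximum of the labels ℓ_i = x_i ⊕ x_{i+1} is attained exactly at the split index m. -/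
/-- If `x < y` lexicographically and they agree below `k`, then `x k ≤ y k`. -/
theorem lexLt.apply_le {w : ℕ} {x y : Fin w → Bool} (h : lexLt x y) {k : Fin w}
    (hagree : ∀ i < k, x i = y i) : x k ≤ y k := by
  obtain ⟨j, hj, hlt⟩ := h
  rcases lt_trichotomy j k with hjk | rfl | hjk
  · exact absurd (hagree j hjk) hlt.ne
  · exact hlt.le
  · exact (hj k hjk).le

/-- **The maximal consecutive-XOR label sits at the split index.**
Let `x 0 < x 1 < ⋯ < x (n−1)` be lexicographically sorted bitstrings
(`n ≥ 2`), let `k` be the smallest coordinate at which not all of them agree,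
and let `m` be the index with `x m (k) = false` and `x (m+1) (k) = true`.
Then for every `i ≠ m` (with `i + 1 < n`) the consecutive XOR satisfies
`x i ⊕ x (i+1) < x m ⊕ x (m+1)` lexicographically. -/
theorem stmt_9 (w n : ℕ) (hw : 1 ≤ w) (hn : 2 ≤ n)
    (x : Fin n → Fin w → Bool)
    (hsorted : ∀ i j : Fin n, i < j → lexLt (x i) (x j))
    (k : ℕ) (hk : k < w)
    (hagree : ∀ i : Fin w, (i : ℕ) < k → ∀ p q : Fin n, x p i = x q i)
    (hdiff : ∃ p q : Fin n, x p ⟨k, hk⟩ ≠ x q ⟨k, hk⟩)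
    (m : ℕ) (hm : m + 1 < n)
    (hm0 : x ⟨m, by omega⟩ ⟨k, hk⟩ = false)
    (hm1 : x ⟨m + 1, hm⟩ ⟨k, hk⟩ = true)
    (i : ℕ) (hi : i + 1 < n) (him : i ≠ m) :
    lexLt (fxor (x ⟨i, by omega⟩) (x ⟨i + 1, hi⟩))
          (fxor (x ⟨m, by omega⟩) (x ⟨m + 1, hm⟩)) := by
  have hmono : Monotone fun p => x p ⟨k, hk⟩ := by
    intro p q hpq
    rcases hpq.eq_or_lt with rfl | hlt
    · exact le_rfl
    · exact (hsorted p q hlt).apply_le fun j hj => hagree j hj p q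
  have heq : x ⟨i, by omega⟩ ⟨k, hk⟩ = x ⟨i + 1, hi⟩ ⟨k, hk⟩ := by
    rcases lt_or_gt_of_ne him with hlt | hgt
    · have hfalse : ∀ p : Fin n, (p : ℕ) ≤ m → x p ⟨k, hk⟩ = false := fun p hp =>
        le_bot_iff.mp ((hmono (show p ≤ ⟨m, by omega⟩ from hp)).trans hm0.le)
      rw [hfalse ⟨i, by omega⟩ hlt.le, hfalse ⟨i + 1, hi⟩ hlt]
    · have htrue : ∀ p : Fin n, m + 1 ≤ (p : ℕ) → x p ⟨k, hk⟩ = true := fun p hp =>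
        top_le_iff.mp (hm1.ge.trans (hmono (show ⟨m + 1, hm⟩ ≤ p from hp)))
      rw [htrue ⟨i, by omega⟩ hgt, htrue ⟨i + 1, hi⟩ (Nat.le_succ_of_le hgt)]
  refine ⟨⟨k, hk⟩, fun j hj => ?_, ?_⟩
  · simp only [fxor]
    rw [hagree j hj ⟨i, by omega⟩ ⟨i + 1, hi⟩, hagree j hj ⟨m, by omega⟩ ⟨m + 1, hm⟩,
      Bool.xor_self, Bool.xor_self]
  · simp [fxor, heq, hm0, hm1]
end

section
/- Let h₁ : {0,1}^w → {0,1}^r, h₂₁ : {0,1}^w → {0,1}^p, and h₂₂ : {0,1}^w → {0,1}^p be ℤ₂-linear maps (i.e., h(x ⊕ y) = h(x) ⊕ h(y) for all x, y), let X ⊆ {0,1}^w, and for u ∈ {0,1}^r define the bucket X_u = {x ∈ X : h₁(x) = u}. For u ∈ {0,1}^r and v ∈ {0,1}^p define the shifted sets X_{u,v}^↑ = {(h₂₁(x) ⊕ v, h₂₂(x)) : x ∈ X_u} and X_{u,v}^↓ = {(h₂₁(x), h₂₂(x) ⊕ v) : x ∈ X_u}. Then for every u ∈ {0,1}^r and every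 c ∈ X: if there exist a, b ∈ X with a ⊕ b = c and a ∈ X_u, then X_{u, h₂₁(c)}^↑ ∩ X_{u ⊕ h₁(c), h₂₂(c)}^↓ ≠ ∅. -/
theorem fxor_fxor_cancel_left {w : ℕ} (x y : Fin w → Bool) : fxor x (fxor x y) = y := by
  funext i
  simp [fxor]

theorem fxor_fxor_cancel_right {w : ℕ} (x y : Fin w → Bool) : fxor y (fxor x y) = x := by
  funext i
  simp [fxor, Bool.xor_left_comm]

/-- **Correctness core of the reduction from 3XOR to offline SetDisjointness /
SetIntersection.**  Let `h₁, h₂₁, h₂₂` be `ℤ₂`-linear hash functions, let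
`X_u = {x ∈ X : h₁ x = u}` be the buckets of `X`, and define the shifted sets
`X_{u,v}^↑ = {(h₂₁ x ⊕ v, h₂₂ x) : x ∈ X_u}` and
`X_{u,v}^↓ = {(h₂₁ x, h₂₂ x ⊕ v) : x ∈ X_u}`.  If `c ∈ X` and there are
`a, b ∈ X` with `a ⊕ b = c` and `a ∈ X_u`, then
`X_{u, h₂₁(c)}^↑ ∩ X_{u ⊕ h₁(c), h₂₂(c)}^↓ ≠ ∅`. -/
theorem stmt_13 (w r p : ℕ)
    (h₁ : (Fin w → Bool) → (Fin r → Bool))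
    (h₂₁ h₂₂ : (Fin w → Bool) → (Fin p → Bool))
    (hlin₁ : ∀ x y, h₁ (fxor x y) = fxor (h₁ x) (h₁ y))
    (hlin₂₁ : ∀ x y, h₂₁ (fxor x y) = fxor (h₂₁ x) (h₂₁ y))
    (hlin₂₂ : ∀ x y, h₂₂ (fxor x y) = fxor (h₂₂ x) (h₂₂ y))
    (X : Set (Fin w → Bool))
    (u : Fin r → Bool) (c : Fin w → Bool) (hc : c ∈ X)
    (hsol : ∃ a b, a ∈ X ∧ b ∈ X ∧ fxor a b = c ∧ h₁ a = u) :
    (({ y | ∃ x ∈ X, h₁ x = u ∧ y = (fxor (h₂₁ x) (h₂₁ c), h₂₂ x) } ∩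
      { y | ∃ x ∈ X, h₁ x = fxor u (h₁ c) ∧ y = (h₂₁ x, fxor (h₂₂ x) (h₂₂ c)) }
      : Set ((Fin p → Bool) × (Fin p → Bool)))).Nonempty := by
  obtain ⟨a, b, ha, hb, rfl, rfl⟩ := hsol
  refine ⟨(h₂₁ b, h₂₂ a), ⟨a, ha, rfl, ?_⟩, ⟨b, hb, ?_, ?_⟩⟩
  · rw [hlin₂₁, fxor_fxor_cancel_left]
  · rw [hlin₁, fxor_fxor_cancel_left]
  · rw [hlin₂₂, fxor_fxor_cancel_right]
end
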